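/- arXiv:1007.2676 — 6 statements merged into one kernel-verified Lean document; each statement's English description precedes it below -/
import Mathlib

section
/- Let p be a complex number with \(p^{2}+4 \neq 0\) and let r be a positive even integer. Then for every non-negative integer n, \(\sum_{k=0}^{n} \binom{2n}{n+k} u_{k}^{2r} = \frac{1}{(p^{2}+4)^{r}}\left(\binom{2r}{r} 2^{2n-1} + \sum_{i=0}^{r-1} (-1)^{i(n+1)} \binom{2r}{i} v_{r-i}^{2n}\right)\), where \(2^{2n-1}\) is interpreted in the complex (or rational) numbers when n = 0. -/
/-- Generalized Fibonacci sequence: `u 0 = 0`, `u 1 = 1`, `u (n+2) = p * u (n+1) + u n`. -/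
def genFib (p : ℂ) : ℕ → ℂ
  | 0 => 0
  | 1 => 1
  | n + 2 => p * genFib p (n + 1) + genFib p n

/-- Generalized Lucas sequence: `v 0 = 2`, `v 1 = p`, `v (n+2) = p * v (n+1) + v n`. -/
def genLucas (p : ℂ) : ℕ → ℂ
  | 0 => 2
  | 1 => p
  | n + 2 => p * genLucas p (n + 1) + genLucas p n

open Finset in
/-- Folding a sum over an even-indexed row of the Pascal triangle around its middle entry. -/
lemma sum_range_choose_mul_fold {R : Type*} [CommSemiring R] (m : ℕ) (g : ℕ → R) :
    ∑ i ∈ range (2 * m + 1), ((2 * m).choose i : R) * g i =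
      ∑ i ∈ range m, ((2 * m).choose i : R) * (g i + g (2 * m - i)) +
        ((2 * m).choose m : R) * g m := by
  have h : ∑ i ∈ range m, ((2 * m).choose (m + 1 + i) : R) * g (m + 1 + i) =
      ∑ i ∈ range m, ((2 * m).choose i : R) * g (2 * m - i) := by
    rw [← sum_range_reflect]
    refine sum_congr rfl fun i hi => ?_
    have hi := mem_range.mp hi
    rw [show m + 1 + (m - 1 - i) = 2 * m - i by omega, Nat.choose_symm (by omega)]
  rw [show 2 * m + 1 = m + 1 + m by omega, sum_range_add, h, sum_range_succ]
  simp only [mul_add, sum_add_distrib]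
  ring

open Finset in
/-- The symmetric binomial theorem for a pair of mutually inverse elements. -/
lemma sum_choose_mul_pow_add_pow {R : Type*} [CommSemiring R] {x y : R} (hxy : x * y = 1)
    (n : ℕ) :
    ∑ k ∈ range (n + 1), ((2 * n).choose (n + k) : R) * (x ^ k + y ^ k) =
      (x + 2 + y) ^ n + ((2 * n).choose n : R) := by
  have hexp : (x + 2 + y) ^ n =
      ∑ i ∈ range (2 * n + 1), ((2 * n).choose i : R) * (x ^ i * y ^ n) := by
    have h : x + 2 + y = (x + 1) ^ 2 * y := by
      calc x + 2 + y = x * (x * y) + 2 * (x * y) + y := by rw [hxy, mul_one, mul_one]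
        _ = (x + 1) ^ 2 * y := by ring
    rw [h, mul_pow, ← pow_mul, add_pow, sum_mul]
    refine sum_congr rfl fun i _ => ?_
    rw [one_pow]
    ring
  have hinv (k : ℕ) : x ^ k * y ^ k = 1 := by rw [← mul_pow, hxy, one_pow]
  rw [hexp, sum_range_choose_mul_fold, ← sum_range_reflect, sum_range_succ, add_assoc]
  congr 1
  · refine sum_congr rfl fun i hi => ?_
    obtain ⟨k, rfl⟩ := Nat.exists_eq_add_of_lt (mem_range.mp hi)
    rw [show i + k + 1 + 1 - 1 - i = k + 1 by omega,
      show 2 * (i + k + 1) - i = (k + 1) + (i + k + 1) by omega,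
      Nat.choose_symm_of_eq_add
        (show 2 * (i + k + 1) = i + k + 1 + (k + 1) + i by omega)]
    have h₁ : x ^ i * y ^ (i + k + 1) = y ^ (k + 1) := by
      rw [add_assoc, pow_add, ← mul_assoc, hinv, one_mul]
    have h₂ : x ^ (k + 1 + (i + k + 1)) * y ^ (i + k + 1) = x ^ (k + 1) := by
      rw [pow_add, mul_assoc, hinv, mul_one]
    rw [h₁, h₂, add_comm (x ^ _)]
  · simp [hinv, mul_add]

lemma sub_mul_genFib {p a b : ℂ} (hadd : a + b = p) (hmul : a * b = -1) :
    ∀ k : ℕ, (a - b) * genFib p k = a ^ k - b ^ k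
  | 0 => by simp [genFib]
  | 1 => by simp [genFib]
  | k + 2 => by
    have h₁ := sub_mul_genFib hadd hmul (k + 1)
    have h₀ := sub_mul_genFib hadd hmul k
    rw [genFib]
    linear_combination p * h₁ + h₀ - (a ^ (k + 1) - b ^ (k + 1)) * hadd
      + (a ^ k - b ^ k) * hmul

lemma genLucas_eq_pow_add_pow {p a b : ℂ} (hadd : a + b = p) (hmul : a * b = -1) :
    ∀ k : ℕ, genLucas p k = a ^ k + b ^ k
  | 0 => by norm_num [genLucas]
  | 1 => by simp [genLucas, hadd]
  | k + 2 => by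
    have h₁ := genLucas_eq_pow_add_pow hadd hmul (k + 1)
    have h₀ := genLucas_eq_pow_add_pow hadd hmul k
    rw [genLucas]
    linear_combination p * h₁ + h₀ - (a ^ (k + 1) + b ^ (k + 1)) * hadd
      + (a ^ k + b ^ k) * hmul

open Finset in
/-- Folded binomial expansion of an even power of `a ^ k - b ^ k` when `a * b = -1`. -/
lemma pow_sub_pow_pow_two_mul {R : Type*} [CommRing R] {a b : R} (hmul : a * b = -1) {r : ℕ}
    (hr : Even r) (k : ℕ) :
    (a ^ k - b ^ k) ^ (2 * r) =
      ∑ i ∈ range r, ((2 * r).choose i : R) * ((-1) ^ i *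
        (((-1) ^ i * a ^ (2 * (r - i))) ^ k + ((-1) ^ i * b ^ (2 * (r - i))) ^ k)) +
      ((2 * r).choose r : R) := by
  have hexp : (a ^ k - b ^ k) ^ (2 * r) = ∑ i ∈ range (2 * r + 1),
      ((2 * r).choose i : R) * ((-b ^ k) ^ i * (a ^ k) ^ (2 * r - i)) := by
    rw [sub_eq_neg_add, add_pow]
    exact sum_congr rfl fun i _ => by ring
  have hinv (i : ℕ) : (a ^ k) ^ i * (b ^ k) ^ i = ((-1) ^ i) ^ k := by
    rw [← hmul]
    ring
  rw [hexp, sum_range_choose_mul_fold]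
  congr 1
  · refine sum_congr rfl fun i hi => ?_
    obtain ⟨m, rfl⟩ := Nat.exists_eq_add_of_le (mem_range.mp hi).le
    rw [show 2 * (i + m) - (2 * (i + m) - i) = i by omega,
      show 2 * (i + m) - i = i + 2 * m by omega, Nat.add_sub_cancel_left,
      neg_pow (b ^ k) i, neg_pow (b ^ k) (i + 2 * m), pow_add (-1 : R) i, pow_mul (-1 : R) 2,
      neg_one_sq, one_pow, mul_one, mul_pow, mul_pow, ← hinv]
    ring
  · rw [show 2 * r - r = r by omega, neg_pow (b ^ k), hr.neg_one_pow, one_mul,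
      mul_comm ((b ^ k) ^ r), hinv, hr.neg_one_pow, one_pow, mul_one]

/-- Theorem (even case): for `p ∈ ℂ` with `p² + 4 ≠ 0`, `r` a positive even integer and
`n ≥ 0`, `∑_{k=0}^n C(2n, n+k) u_k^{2r}
  = (1/(p²+4)^r) (C(2r,r) 2^{2n-1} + ∑_{i=0}^{r-1} (-1)^{i(n+1)} C(2r,i) v_{r-i}^{2n})`,
where `2^{2n-1}` is interpreted as a complex (integer-exponent) power. -/
theorem sum_genFib_pow_even (p : ℂ) (hp : p ^ 2 + 4 ≠ 0) (r : ℕ) (hr : 0 < r)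
    (hre : Even r) (n : ℕ) :
    ∑ k ∈ Finset.range (n + 1),
        ((Nat.choose (2 * n) (n + k) : ℂ) * genFib p k ^ (2 * r)) =
      (1 / (p ^ 2 + 4) ^ r) *
        ((Nat.choose (2 * r) r : ℂ) * (2 : ℂ) ^ (2 * (n : ℤ) - 1) +
          ∑ i ∈ Finset.range r,
            (-1 : ℂ) ^ (i * (n + 1)) * (Nat.choose (2 * r) i : ℂ) *
              genLucas p (r - i) ^ (2 * n)) := by
  obtain ⟨s, hs⟩ := IsAlgClosed.exists_pow_nat_eq (p ^ 2 + 4) (n := 2) two_pos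
  obtain ⟨a, b, hadd, hmul, hsub⟩ :
      ∃ a b : ℂ, a + b = p ∧ a * b = -1 ∧ (a - b) ^ 2 = p ^ 2 + 4 :=
    ⟨(p + s) / 2, (p - s) / 2, by ring, by linear_combination -hs / 4,
      by linear_combination hs⟩
  have hfib (k : ℕ) : (p ^ 2 + 4) ^ r * genFib p k ^ (2 * r) = (a ^ k - b ^ k) ^ (2 * r) := by
    rw [← sub_mul_genFib hadd hmul, mul_pow, pow_mul (a - b), hsub]
  have hvanish := pow_sub_pow_pow_two_mul hmul hre 0
  simp only [pow_zero, sub_self, zero_pow (show 2 * r ≠ 0 by omega)] at hvanish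
  have hrow := sum_choose_mul_pow_add_pow (one_mul (1 : ℂ)) n
  simp only [one_pow, ← Finset.sum_mul] at hrow
  have hinner (i : ℕ) (hi : i ∈ Finset.range r) :
      ∑ k ∈ Finset.range (n + 1), ((2 * n).choose (n + k) : ℂ) *
        (((-1) ^ i * a ^ (2 * (r - i))) ^ k + ((-1) ^ i * b ^ (2 * (r - i))) ^ k) =
      (-1) ^ (i * n) * genLucas p (r - i) ^ (2 * n) + ((2 * n).choose n : ℂ) := by
    have hsq : ((-1 : ℂ) ^ i) * (-1) ^ i = 1 := by rw [← mul_pow]; norm_num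
    have hpar : (-1 : ℂ) ^ (r - i) = (-1) ^ i := by
      have h : (-1 : ℂ) ^ (r - i) * (-1) ^ i = 1 := by
        rw [← pow_add, Nat.sub_add_cancel (Finset.mem_range.mp hi).le, hre.neg_one_pow]
      linear_combination (-1 : ℂ) ^ i * h - (-1 : ℂ) ^ (r - i) * hsq
    have hab : a ^ (r - i) * b ^ (r - i) = (-1) ^ i := by rw [← mul_pow, hmul, hpar]
    rw [sum_choose_mul_pow_add_pow, pow_mul (-1 : ℂ), pow_mul (genLucas p _), ← mul_pow,
      genLucas_eq_pow_add_pow hadd hmul]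
    · congr 2
      linear_combination -2 * (-1 : ℂ) ^ i * hab - 2 * hsq
    · linear_combination (a ^ (r - i) * b ^ (r - i)) ^ 2 * hsq
        + (a ^ (r - i) * b ^ (r - i) + (-1) ^ i) * hab + hsq
  have htwo : (2 : ℂ) ^ (2 * (n : ℤ) - 1) = (1 + 2 + 1) ^ n / 2 := by
    rw [zpow_sub_one₀ two_ne_zero, zpow_mul, zpow_natCast, div_eq_mul_inv]
    norm_num
  have hmain : (p ^ 2 + 4) ^ r * ∑ k ∈ Finset.range (n + 1),
      ((2 * n).choose (n + k) : ℂ) * genFib p k ^ (2 * r) =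
      ∑ i ∈ Finset.range r, ((2 * r).choose i : ℂ) * ((-1) ^ i *
        ((-1) ^ (i * n) * genLucas p (r - i) ^ (2 * n) + ((2 * n).choose n : ℂ))) +
      (∑ k ∈ Finset.range (n + 1), ((2 * n).choose (n + k) : ℂ)) * ((2 * r).choose r : ℂ) := by
    rw [Finset.mul_sum]
    simp_rw [mul_left_comm ((p ^ 2 + 4) ^ r), hfib, pow_sub_pow_pow_two_mul hmul hre, mul_add _ _
      ((2 * r).choose r : ℂ), Finset.sum_add_distrib, ← Finset.sum_mul, Finset.mul_sum]
    rw [Finset.sum_comm]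
    congr 1
    refine Finset.sum_congr rfl fun i hi => ?_
    rw [← hinner i hi, Finset.mul_sum, Finset.mul_sum]
    exact Finset.sum_congr rfl fun k _ => by ring
  have hsplit : ∑ i ∈ Finset.range r, ((2 * r).choose i : ℂ) * ((-1) ^ i *
        ((-1) ^ (i * n) * genLucas p (r - i) ^ (2 * n) + ((2 * n).choose n : ℂ))) =
      ∑ i ∈ Finset.range r, (-1 : ℂ) ^ (i * (n + 1)) * ((2 * r).choose i : ℂ) *
        genLucas p (r - i) ^ (2 * n) +
      (∑ i ∈ Finset.range r, ((2 * r).choose i : ℂ) * ((-1) ^ i * (1 + 1))) *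
        (((2 * n).choose n : ℂ) / 2) := by
    rw [Finset.sum_mul, ← Finset.sum_add_distrib]
    exact Finset.sum_congr rfl fun i _ => by ring
  rw [one_div, eq_inv_mul_iff_mul_eq₀ (pow_ne_zero r hp), hmain, hsplit, htwo]
  linear_combination ((2 * r).choose r : ℂ) / 2 * hrow - ((2 * n).choose n : ℂ) / 2 * hvanish
end

section
/- Let p be a complex number with \(p^{2}+4 \neq 0\) and let r be a positive odd integer. Then for every positive integer n, \(\sum_{k=0}^{n} \binom{2n}{n+k} u_{k}^{2r} = (p^{2}+4)^{n-r} \sum_{i=0}^{r-1} (-1)^{i(n+1)} \binom{2r}{i} u_{r-i}^{2n}\), where for \(n < r\) the power \((p^{2}+4)^{n-r}\) is interpreted as \(1/(p^{2}+4)^{r-n}\). -/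
/-- Folding a symmetrically weighted sum of an even function onto its lower half. -/
theorem sum_range_symm_fold_low {R : Type*} [CommRing R] (N : ℕ) (c : ℕ → R) (f : ℤ → R)
    (hc : ∀ j ≤ 2 * N, c (2 * N - j) = c j) (hf : ∀ k, f (-k) = f k) (h0 : f 0 = 0) :
    ∑ j ∈ Finset.range (2 * N + 1), c j * f ((j : ℤ) - N) =
      2 * ∑ i ∈ Finset.range N, c i * f ((N : ℤ) - i) := by
  have hlow : ∑ j ∈ Finset.range N, c j * f ((j : ℤ) - N) =
      ∑ i ∈ Finset.range N, c i * f ((N : ℤ) - i) :=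
    Finset.sum_congr rfl fun j _ => by rw [← hf, neg_sub]
  have hhigh : ∑ j ∈ Finset.range N, c (N + 1 + j) * f (((N + 1 + j : ℕ) : ℤ) - N) =
      ∑ i ∈ Finset.range N, c i * f ((N : ℤ) - i) := by
    rw [← Finset.sum_range_reflect]
    refine Finset.sum_congr rfl fun j hj => ?_
    have hj := Finset.mem_range.mp hj
    rw [← hc j (by omega)]
    congr 2 <;> omega
  rw [show 2 * N + 1 = N + 1 + N by ring, Finset.sum_range_add, Finset.sum_range_succ, hlow,
    hhigh, sub_self, h0]
  ring

/-- Folding a symmetrically weighted sum of an even function onto its upper half. -/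
theorem sum_range_symm_fold_high {R : Type*} [CommRing R] (N : ℕ) (c : ℕ → R) (f : ℤ → R)
    (hc : ∀ j ≤ 2 * N, c (2 * N - j) = c j) (hf : ∀ k, f (-k) = f k) (h0 : f 0 = 0) :
    ∑ j ∈ Finset.range (2 * N + 1), c j * f ((j : ℤ) - N) =
      2 * ∑ k ∈ Finset.range (N + 1), c (N + k) * f k := by
  rw [sum_range_symm_fold_low N c f hc hf h0, ← Finset.sum_range_reflect, Finset.sum_range_succ']
  simp only [Nat.cast_zero, h0, mul_zero, add_zero]
  congr 1
  refine Finset.sum_congr rfl fun j hj => ?_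
  have hj := Finset.mem_range.mp hj
  rw [← hc (N - 1 - j) (by omega)]
  congr 2 <;> omega

/-- Binet's formula, for the roots `a` and `b` of `X ^ 2 - p * X - 1`. -/
theorem genFib_mul_sub {p a b : ℂ} (ha : a ^ 2 = p * a + 1) (hb : b ^ 2 = p * b + 1) (n : ℕ) :
    genFib p n * (a - b) = a ^ n - b ^ n := by
  induction n using Nat.twoStepInduction with
  | zero => simp [genFib]
  | one => simp [genFib]
  | more n h0 h1 =>
    simp only [genFib]
    linear_combination p * h1 + h0 - a ^ n * ha + b ^ n * hb

theorem zpow_sub_zpow_neg_sq {a b : ℂ} (hab : a * b = -1) (k : ℤ) :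
    (a ^ (-k) - b ^ (-k)) ^ 2 = (a ^ k - b ^ k) ^ 2 := by
  have ha : a ^ k ≠ 0 := zpow_ne_zero _ (by rintro rfl; simp at hab)
  have hb : b ^ k ≠ 0 := zpow_ne_zero _ (by rintro rfl; simp at hab)
  have h : (a ^ k * b ^ k) ^ 2 = 1 := by
    rw [← mul_zpow, hab, ← zpow_natCast, zpow_comm]
    norm_num
  rw [zpow_neg, zpow_neg, inv_sub_inv ha hb, div_pow, h, div_one]
  ring

/-- The expansion of `(1 + x) ^ (2 * n) / x ^ n`. -/
theorem sum_choose_mul_zpow {x : ℂ} (hx : x ≠ 0) (n : ℕ) :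
    ∑ j ∈ Finset.range (2 * n + 1), ((2 * n).choose j : ℂ) * x ^ ((j : ℤ) - n) =
      ((1 + x) ^ 2 / x) ^ n := by
  rw [div_pow, ← pow_mul, add_comm 1 x, add_pow, Finset.sum_div]
  refine Finset.sum_congr rfl fun j _ => ?_
  rw [zpow_sub₀ hx, zpow_natCast, zpow_natCast, one_pow]
  ring

theorem one_add_sq_div {a b : ℂ} (hab : a * b = -1) {r : ℕ} (hr : Odd r) {i : ℕ}
    (hi : i ≤ 2 * r) :
    (1 + b ^ i * a ^ (2 * r - i)) ^ 2 / (b ^ i * a ^ (2 * r - i)) =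
      (-1) ^ i * (a ^ ((r : ℤ) - i) - b ^ ((r : ℤ) - i)) ^ 2 := by
  have ha : a ≠ 0 := by rintro rfl; simp at hab
  have hb : b = -1 * a⁻¹ := by field_simp; linear_combination hab
  have he : ((-1 : ℂ) ^ i) ^ 2 = 1 := by rw [← pow_mul, mul_comm, pow_mul]; norm_num
  have he' : (-1 : ℂ) ^ ((r : ℤ) - i) = -(-1) ^ i := by
    rw [zpow_sub₀ (by norm_num), zpow_natCast, zpow_natCast, hr.neg_one_pow]
    have := pow_ne_zero i (show (-1 : ℂ) ≠ 0 by norm_num)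
    field_simp
    linear_combination he
  have hy : a ^ ((r : ℤ) - i) ≠ 0 := zpow_ne_zero _ ha
  have hx : b ^ i * a ^ (2 * r - i) = (-1) ^ i * (a ^ ((r : ℤ) - i)) ^ 2 := by
    rw [hb, mul_pow, mul_assoc, ← zpow_natCast a⁻¹, inv_zpow', ← zpow_natCast a,
      ← zpow_add₀ ha, ← zpow_natCast (a ^ _), ← zpow_mul]
    congr 2
    omega
  have hbm : b ^ ((r : ℤ) - i) = -(-1) ^ i * (a ^ ((r : ℤ) - i))⁻¹ := by
    rw [hb, mul_zpow, he', inv_zpow]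
  rw [hx, hbm]
  generalize a ^ ((r : ℤ) - i) = y at *
  generalize (-1 : ℂ) ^ i = e at *
  have hne : e ≠ 0 := by rintro rfl; simp at he
  field_simp
  linear_combination (y ^ 4 - 1 - (y ^ 2 + e) ^ 2) * he

/-- Theorem (odd case): for `p ∈ ℂ` with `p² + 4 ≠ 0`, `r` a positive odd integer and
`n ≥ 1`, `∑_{k=0}^n C(2n, n+k) u_k^{2r}
  = (p²+4)^{n-r} ∑_{i=0}^{r-1} (-1)^{i(n+1)} C(2r,i) u_{r-i}^{2n}`,
where `(p²+4)^{n-r}` is an integer-exponent power (so `1/(p²+4)^{r-n}` when `n < r`). -/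
theorem sum_genFib_pow_odd (p : ℂ) (hp : p ^ 2 + 4 ≠ 0) (r : ℕ) (hr : 0 < r)
    (hro : Odd r) (n : ℕ) (hn : 0 < n) :
    ∑ k ∈ Finset.range (n + 1),
        ((Nat.choose (2 * n) (n + k) : ℂ) * genFib p k ^ (2 * r)) =
      (p ^ 2 + 4) ^ ((n : ℤ) - (r : ℤ)) *
        ∑ i ∈ Finset.range r,
          (-1 : ℂ) ^ (i * (n + 1)) * (Nat.choose (2 * r) i : ℂ) *
            genFib p (r - i) ^ (2 * n) := by
  obtain ⟨s, hs⟩ := IsAlgClosed.exists_pow_nat_eq (p ^ 2 + 4) (n := 2) (by norm_num)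
  obtain ⟨a, b, hab, hD, ha, hb⟩ : ∃ a b : ℂ, a * b = -1 ∧ (a - b) ^ 2 = p ^ 2 + 4 ∧
      a ^ 2 = p * a + 1 ∧ b ^ 2 = p * b + 1 :=
    ⟨(p + s) / 2, (p - s) / 2, by linear_combination -hs / 4, by linear_combination hs,
      by linear_combination hs / 4, by linear_combination hs / 4⟩
  have ha0 : a ≠ 0 := by rintro rfl; simp at hab
  have hb0 : b ≠ 0 := by rintro rfl; simp at hab
  have hu (k m : ℕ) : (a ^ (k : ℤ) - b ^ (k : ℤ)) ^ (2 * m) =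
      (p ^ 2 + 4) ^ m * genFib p k ^ (2 * m) := by
    rw [zpow_natCast, zpow_natCast, ← genFib_mul_sub ha hb, mul_pow, pow_mul (a - b), hD, mul_comm]
  have heven (m : ℕ) (k : ℤ) :
      (a ^ (-k) - b ^ (-k)) ^ (2 * m) = (a ^ k - b ^ k) ^ (2 * m) := by
    rw [pow_mul, zpow_sub_zpow_neg_sq hab, ← pow_mul]
  have hleft := sum_range_symm_fold_high n (fun j => ((2 * n).choose j : ℂ))
    (fun k => (a ^ k - b ^ k) ^ (2 * r)) (fun j hj => by simp [Nat.choose_symm hj])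
    (heven r) (by simp [hr.ne'])
  have hright := sum_range_symm_fold_low r
    (fun i => (-1 : ℂ) ^ (i * (n + 1)) * ((2 * r).choose i : ℂ))
    (fun k => (a ^ k - b ^ k) ^ (2 * n))
    (fun j hj => by
      have h : (-1 : ℂ) ^ (2 * r - j) = (-1) ^ j := by
        rw [neg_one_pow_congr]
        rw [Nat.even_sub hj]
        simp
      simp only [Nat.choose_symm hj, pow_mul, h])
    (heven n) (by simp [hn.ne'])
  have hdouble : ∑ j ∈ Finset.range (2 * n + 1), ((2 * n).choose j : ℂ) *
        (a ^ ((j : ℤ) - n) - b ^ ((j : ℤ) - n)) ^ (2 * r) =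
      ∑ i ∈ Finset.range (2 * r + 1), (-1 : ℂ) ^ (i * (n + 1)) * ((2 * r).choose i : ℂ) *
        (a ^ ((r : ℤ) - i) - b ^ ((r : ℤ) - i)) ^ (2 * n) := by
    have hterm (k : ℤ) : (a ^ k - b ^ k) ^ (2 * r) = ∑ i ∈ Finset.range (2 * r + 1),
        (-1 : ℂ) ^ i * ((2 * r).choose i : ℂ) * (b ^ i * a ^ (2 * r - i)) ^ k := by
      rw [sub_eq_neg_add, add_pow]
      refine Finset.sum_congr rfl fun i _ => ?_
      rw [neg_pow, mul_zpow, ← zpow_natCast b, ← zpow_natCast a, ← zpow_mul, ← zpow_mul,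
        mul_comm _ k, mul_comm _ k, zpow_mul, zpow_mul, zpow_natCast, zpow_natCast]
      ring
    simp only [hterm, Finset.mul_sum]
    rw [Finset.sum_comm]
    refine Finset.sum_congr rfl fun i hi => ?_
    have hi : i ≤ 2 * r := Nat.lt_succ_iff.mp (Finset.mem_range.mp hi)
    simp only [mul_left_comm _ ((-1 : ℂ) ^ i * _), ← Finset.mul_sum]
    rw [sum_choose_mul_zpow (mul_ne_zero (pow_ne_zero _ hb0) (pow_ne_zero _ ha0)),
      one_add_sq_div hab hro hi, mul_pow, ← pow_mul, ← pow_mul]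
    ring
  have hflip : ∑ i ∈ Finset.range (2 * r + 1), (-1 : ℂ) ^ (i * (n + 1)) *
        ((2 * r).choose i : ℂ) * (a ^ ((r : ℤ) - i) - b ^ ((r : ℤ) - i)) ^ (2 * n) =
      ∑ i ∈ Finset.range (2 * r + 1), (-1 : ℂ) ^ (i * (n + 1)) *
        ((2 * r).choose i : ℂ) * (a ^ ((i : ℤ) - r) - b ^ ((i : ℤ) - r)) ^ (2 * n) :=
    Finset.sum_congr rfl fun i _ => by rw [← heven, neg_sub]
  have hmain := (hleft.symm.trans (hdouble.trans hflip)).trans hright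
  have hlow : ∑ i ∈ Finset.range r, (-1 : ℂ) ^ (i * (n + 1)) * ((2 * r).choose i : ℂ) *
        (a ^ ((r : ℤ) - i) - b ^ ((r : ℤ) - i)) ^ (2 * n) =
      (p ^ 2 + 4) ^ n * ∑ i ∈ Finset.range r, (-1 : ℂ) ^ (i * (n + 1)) *
        ((2 * r).choose i : ℂ) * genFib p (r - i) ^ (2 * n) := by
    rw [Finset.mul_sum]
    refine Finset.sum_congr rfl fun i hi => ?_
    rw [← Nat.cast_sub (Finset.mem_range.mp hi).le, hu]
    ring
  simp only [hu, mul_left_comm _ ((p ^ 2 + 4) ^ r), ← Finset.mul_sum, hlow] at hmain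
  rw [zpow_sub₀ hp, zpow_natCast, zpow_natCast, div_mul_eq_mul_div,
    eq_div_iff (pow_ne_zero r hp)]
  linear_combination hmain / 2
end

section
/- Let p be a complex number and let r be a positive even integer. Then for every non-negative integer n, \(\sum_{k=0}^{n} \binom{2n}{n+k} v_{k}^{2r} = \binom{2r}{r} 2^{2n-1} + 2^{2r-1}\binom{2n}{n} + \sum_{i=0}^{r-1} (-1)^{in} \binom{2r}{i} v_{r-i}^{2n}\), where \(2^{2n-1}\) is interpreted in the complex (or rational) numbers when n = 0. -/
/-- The two-sided Binet expression `a ^ m + (-1 / a) ^ m`. -/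
noncomputable def binetLucas (a : ℂ) (m : ℤ) : ℂ := a ^ m + (-1) ^ m * a ^ (-m)

theorem exists_genLucas_eq_binetLucas (p : ℂ) :
    ∃ a : ℂ, a ≠ 0 ∧ ∀ k : ℕ, genLucas p k = binetLucas a k := by
  obtain ⟨s, hs⟩ := IsAlgClosed.exists_pow_nat_eq (p ^ 2 + 4) (n := 2) (by norm_num)
  have hmul : ((p + s) / 2) * ((s - p) / 2) = 1 := by linear_combination hs / 4
  have ha : (p + s) / 2 ≠ 0 := left_ne_zero_of_mul_eq_one hmul
  have hp : p = (p + s) / 2 - ((p + s) / 2)⁻¹ := by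
    rw [inv_eq_of_mul_eq_one_right hmul]; ring
  generalize (p + s) / 2 = a at ha hp
  refine ⟨a, ha, fun k => ?_⟩
  induction k using Nat.twoStepInduction with
  | zero => norm_num [genLucas, binetLucas]
  | one => simp [genLucas, binetLucas, hp, sub_eq_add_neg]
  | more k ih₀ ih₁ =>
    rw [genLucas, ih₀, ih₁, hp]
    simp only [binetLucas, zpow_neg, zpow_natCast]
    field_simp
    ring

theorem binetLucas_neg (a : ℂ) (m : ℤ) :
    binetLucas a (-m) = (-1) ^ m * binetLucas a m := by
  have h : ((-1 : ℂ) ^ m) * (-1) ^ m = 1 := by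
    rw [← mul_zpow]; simp
  have h' : (-1 : ℂ) ^ (-m) = (-1) ^ m := by
    rw [zpow_neg, ← inv_zpow]; norm_num
  simp only [binetLucas, neg_neg, h']
  linear_combination -a ^ (-m) * h

theorem binetLucas_neg_pow_two_mul (a : ℂ) (m : ℤ) (n : ℕ) :
    binetLucas a (-m) ^ (2 * n) = binetLucas a m ^ (2 * n) := by
  have h : ((-1 : ℂ) ^ m) ^ 2 = 1 := by
    rw [pow_two, ← mul_zpow]; simp
  rw [binetLucas_neg, mul_pow, pow_mul, h, one_pow, one_mul]

theorem sum_choose_mul_even_fun (G : ℤ → ℂ) (hG : ∀ m, G (-m) = G m) (n : ℕ) :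
    ∑ j ∈ Finset.range (2 * n + 1), (Nat.choose (2 * n) j : ℂ) * G ((j : ℤ) - n) =
      2 * ∑ k ∈ Finset.range (n + 1), (Nat.choose (2 * n) (n + k) : ℂ) * G k -
        (Nat.choose (2 * n) n : ℂ) * G 0 := by
  have hupper : ∑ k ∈ Finset.range (n + 1),
        (Nat.choose (2 * n) (n + k) : ℂ) * G (((n + k : ℕ) : ℤ) - n) =
      ∑ k ∈ Finset.range (n + 1), (Nat.choose (2 * n) (n + k) : ℂ) * G k := by
    refine Finset.sum_congr rfl fun k _ => ?_
    congr 2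
    push_cast
    ring
  have hlower : ∑ j ∈ Finset.range (n + 1), (Nat.choose (2 * n) j : ℂ) * G ((j : ℤ) - n) =
      ∑ k ∈ Finset.range (n + 1), (Nat.choose (2 * n) (n + k) : ℂ) * G k := by
    rw [← Finset.sum_range_reflect]
    refine Finset.sum_congr rfl fun k hk => ?_
    have hk' : k ≤ n := Nat.lt_succ_iff.mp (Finset.mem_range.mp hk)
    rw [← hG k, show n + 1 - 1 - k = n - k by omega,
      Nat.choose_symm_of_eq_add (show 2 * n = (n - k) + (n + k) by omega)]
    congr 2
    push_cast [hk']
    ring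
  rw [Finset.sum_range_succ] at hlower
  rw [show 2 * n + 1 = n + (n + 1) by ring, Finset.sum_range_add, hupper]
  rw [sub_self] at hlower
  linear_combination hlower

theorem binetLucas_pow {a : ℂ} (ha : a ≠ 0) (m : ℤ) (N : ℕ) :
    binetLucas a m ^ N = ∑ i ∈ Finset.range (N + 1),
      (Nat.choose N i : ℂ) * ((-1) ^ (m * (N - i)) * a ^ (m * (2 * i - N))) := by
  rw [binetLucas, add_pow]
  refine Finset.sum_congr rfl fun i hi => ?_
  have hi' : i ≤ N := Nat.lt_succ_iff.mp (Finset.mem_range.mp hi)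
  rw [mul_pow, ← zpow_natCast (a ^ m), ← zpow_natCast (a ^ (-m)),
    ← zpow_natCast ((-1 : ℂ) ^ m), ← zpow_mul, ← zpow_mul, ← zpow_mul, Nat.cast_sub hi',
    show m * (2 * (i : ℤ) - N) = m * i + -m * (N - i) by ring, zpow_add₀ ha]
  ring

theorem sum_choose_mul_binetLucas_pow {a : ℂ} (ha : a ≠ 0) {r : ℕ} (hr : Even r) (n : ℕ) :
    ∑ j ∈ Finset.range (2 * n + 1),
        (Nat.choose (2 * n) j : ℂ) * binetLucas a ((j : ℤ) - n) ^ (2 * r) =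
      ∑ i ∈ Finset.range (2 * r + 1), (Nat.choose (2 * r) i : ℂ) *
        ((-1) ^ (((i : ℤ) - r) * n) * binetLucas a ((i : ℤ) - r) ^ (2 * n)) := by
  obtain ⟨t, rfl⟩ := hr
  simp only [binetLucas_pow ha, Finset.mul_sum]
  rw [Finset.sum_comm]
  refine Finset.sum_congr rfl fun i _ => Finset.sum_congr rfl fun j _ => ?_
  have hsign : (-1 : ℂ) ^ (((j : ℤ) - n) * ((2 * (t + t) : ℕ) - i)) =
      (-1) ^ (((i : ℤ) - (t + t : ℕ)) * n) *
        (-1) ^ (((i : ℤ) - (t + t : ℕ)) * ((2 * n : ℕ) - j)) := by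
    rw [← zpow_add₀ (by norm_num)]
    have h : ((j : ℤ) - n) * ((2 * (t + t) : ℕ) - i) =
        (((i : ℤ) - (t + t : ℕ)) * n + ((i : ℤ) - (t + t : ℕ)) * ((2 * n : ℕ) - j)) +
          2 * (t * j + t * n - i * n) := by
      push_cast; ring
    rw [h, zpow_add₀ (by norm_num), zpow_mul _ 2]
    simp
  have hexp : ((j : ℤ) - n) * (2 * i - (2 * (t + t) : ℕ)) =
      ((i : ℤ) - (t + t : ℕ)) * (2 * j - (2 * n : ℕ)) := by
    push_cast; ring
  rw [hsign, hexp]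
  ring

/-- Theorem (even case): for `p ∈ ℂ`, `r` a positive even integer and `n ≥ 0`,
`∑_{k=0}^n C(2n, n+k) v_k^{2r}
  = C(2r,r) 2^{2n-1} + 2^{2r-1} C(2n,n) + ∑_{i=0}^{r-1} (-1)^{in} C(2r,i) v_{r-i}^{2n}`,
where `2^{2n-1}` is interpreted as a complex (integer-exponent) power. -/
theorem sum_genLucas_pow_even (p : ℂ) (r : ℕ) (hr : 0 < r) (hre : Even r) (n : ℕ) :
    ∑ k ∈ Finset.range (n + 1),
        ((Nat.choose (2 * n) (n + k) : ℂ) * genLucas p k ^ (2 * r)) =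
      (Nat.choose (2 * r) r : ℂ) * (2 : ℂ) ^ (2 * (n : ℤ) - 1) +
        2 ^ (2 * r - 1) * (Nat.choose (2 * n) n : ℂ) +
        ∑ i ∈ Finset.range r,
          (-1 : ℂ) ^ (i * n) * (Nat.choose (2 * r) i : ℂ) *
            genLucas p (r - i) ^ (2 * n) := by
  obtain ⟨a, ha, hv⟩ := exists_genLucas_eq_binetLucas p
  have hzero : binetLucas a 0 = 2 := by norm_num [binetLucas]
  have hmain := sum_choose_mul_binetLucas_pow ha hre n
  rw [sum_choose_mul_even_fun (fun m => binetLucas a m ^ (2 * r))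
      (fun m => binetLucas_neg_pow_two_mul a m r) n,
    sum_choose_mul_even_fun (fun m => (-1) ^ (m * n) * binetLucas a m ^ (2 * n))
      (fun m => by
        rw [binetLucas_neg_pow_two_mul, neg_mul, zpow_neg, ← inv_zpow]
        norm_num) r,
    Finset.sum_range_succ' _ r, ← Finset.sum_range_reflect _ r] at hmain
  have hsum : ∑ i ∈ Finset.range r, (Nat.choose (2 * r) (r + (r - 1 - i + 1)) : ℂ) *
        ((-1) ^ (((r - 1 - i + 1 : ℕ) : ℤ) * n) *
          binetLucas a ((r - 1 - i + 1 : ℕ) : ℤ) ^ (2 * n)) =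
      ∑ i ∈ Finset.range r, (-1 : ℂ) ^ (i * n) * (Nat.choose (2 * r) i : ℂ) *
        genLucas p (r - i) ^ (2 * n) := by
    refine Finset.sum_congr rfl fun i hi => ?_
    have hi' : i < r := Finset.mem_range.mp hi
    have hsign : (-1 : ℂ) ^ (((r - i : ℕ) : ℤ) * n) = (-1) ^ (i * n) := by
      rw [← Nat.cast_mul, zpow_natCast, pow_mul, pow_mul]
      congr 1
      obtain ⟨t, rfl⟩ := hre
      rw [neg_one_pow_congr]
      grind
    rw [show r - 1 - i + 1 = r - i by omega, hv, hsign,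
      Nat.choose_symm_of_eq_add (show 2 * r = (r + (r - i)) + i by omega)]
    ring
  have htwo : (2 : ℂ) ^ (2 * (n : ℤ) - 1) = 2 ^ (2 * n) / 2 := by
    rw [zpow_sub₀ two_ne_zero, zpow_one]
    norm_cast
  have htwo' : (2 : ℂ) ^ (2 * r) = 2 * 2 ^ (2 * r - 1) := by
    rw [← pow_succ', show 2 * r - 1 + 1 = 2 * r by omega]
  rw [hsum] at hmain
  simp only [hzero, Nat.cast_zero, zero_mul, zpow_zero, one_mul, add_zero, htwo'] at hmain
  simp only [hv] at hmain ⊢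
  rw [htwo]
  linear_combination hmain / 2
end

section
/- For every positive integer n, \(\sum_{k=0}^{n} \binom{2n}{n+k} L_{k}^{2} = 5^{n} + 2\binom{2n}{n}\). -/
/-- The Lucas numbers: `L 0 = 2`, `L 1 = 1`, `L (n+2) = L (n+1) + L n`. -/
def lucas : ℕ → ℕ
  | 0 => 2
  | 1 => 1
  | n + 2 => lucas (n + 1) + lucas n

open Finset in
theorem Finset.sum_range_two_mul_add_one {R : Type*} [AddCommGroup R] (f : ℕ → R) (n : ℕ) :
    ∑ j ∈ range (2 * n + 1), f j = ∑ k ∈ range (n + 1), (f (n + k) + f (n - k)) - f n := by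
  have h := sum_range_reflect f (n + 1)
  rw [Nat.add_sub_cancel] at h
  rw [sum_add_distrib, h, show 2 * n + 1 = n + (n + 1) by ring, sum_range_add, sum_range_succ f n]
  abel

/-- Binet's formula for the Lucas numbers. -/
theorem coe_lucas_eq (n : ℕ) : (lucas n : ℝ) = Real.goldenRatio ^ n + Real.goldenConj ^ n := by
  induction n using Nat.twoStepInduction with
  | zero => norm_num [lucas]
  | one => simp [lucas]
  | more n h₀ h₁ =>
    rw [lucas, Nat.cast_add, h₀, h₁]
    linear_combination (-Real.goldenRatio ^ n) * Real.goldenRatio_sq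
      - Real.goldenConj ^ n * Real.goldenConj_sq

theorem coe_lucas_sq (k : ℕ) :
    (lucas k : ℝ) ^ 2 =
      (Real.goldenRatio ^ 2) ^ k + (Real.goldenConj ^ 2) ^ k + 2 * (-1) ^ k := by
  rw [coe_lucas_eq, ← Real.goldenRatio_mul_goldenConj, mul_pow]
  generalize Real.goldenRatio = x, Real.goldenConj = y
  ring

theorem sum_choose_goldenRatio_sq_pow (n : ℕ) :
    ∑ j ∈ Finset.range (2 * n + 1),
      ((2 * n).choose j : ℝ) * ((Real.goldenConj ^ 2) ^ n * (Real.goldenRatio ^ 2) ^ j) = 5 ^ n := by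
  have h := add_pow (Real.goldenRatio ^ 2) 1 (2 * n)
  have h₅ : Real.goldenConj ^ 2 * (Real.goldenRatio ^ 2 + 1) ^ 2 = 5 := by
    have hc : Real.goldenConj = 1 - Real.goldenRatio := by
      linear_combination Real.goldenRatio_add_goldenConj
    rw [hc]
    have hs := Real.goldenRatio_sq
    generalize Real.goldenRatio = x at hs ⊢
    grind
  rw [← h₅, mul_pow, ← pow_mul _ 2 n, ← pow_mul _ 2 n, h, Finset.mul_sum]
  refine Finset.sum_congr rfl fun j _ => ?_
  rw [one_pow]
  ring

theorem sum_choose_alternating (n : ℕ) (hn : 0 < n) :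
    ∑ j ∈ Finset.range (2 * n + 1), ((2 * n).choose j : ℝ) * ((-1) ^ n * (-1) ^ j) = 0 := by
  have h := add_pow (-1 : ℝ) 1 (2 * n)
  rw [neg_add_cancel, zero_pow (by omega)] at h
  rw [← mul_zero ((-1 : ℝ) ^ n), h, Finset.mul_sum]
  refine Finset.sum_congr rfl fun j _ => ?_
  rw [one_pow]
  ring

/-- For every positive integer `n`, `∑_{k=0}^n C(2n, n+k) L_k² = 5^n + 2 C(2n,n)`. -/
theorem sum_choose_lucas_sq (n : ℕ) (hn : 0 < n) :
    ∑ k ∈ Finset.range (n + 1), Nat.choose (2 * n) (n + k) * lucas k ^ 2 =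
      5 ^ n + 2 * Nat.choose (2 * n) n := by
  have hunit : Real.goldenConj ^ 2 * Real.goldenRatio ^ 2 = 1 := by
    rw [← mul_pow, Real.goldenConj_mul_goldenRatio]; norm_num
  have hB (m : ℕ) : (Real.goldenConj ^ 2) ^ m * (Real.goldenRatio ^ 2) ^ m = 1 := by
    rw [← mul_pow, hunit, one_pow]
  have hsign (m : ℕ) : (-1 : ℝ) ^ m * (-1) ^ m = 1 := by
    rw [← mul_pow]; norm_num
  have h := congrArg₂ (· + ·) (sum_choose_goldenRatio_sq_pow n) (sum_choose_alternating n hn)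
  simp only [← Finset.sum_add_distrib, ← mul_add] at h
  rw [Finset.sum_range_two_mul_add_one, hB, hsign, add_zero, sub_eq_iff_eq_add,
    one_add_one_eq_two] at h
  rify
  rw [mul_comm 2 ((2 * n).choose n : ℝ), ← h]
  refine Finset.sum_congr rfl fun k hk => ?_
  obtain ⟨m, rfl⟩ := Nat.exists_eq_add_of_le (Finset.mem_range_succ_iff.mp hk)
  have hc : (2 * (k + m)).choose (k + m - k) = (2 * (k + m)).choose (k + m + k) :=
    Nat.choose_symm_of_eq_add (by omega)
  rw [hc, Nat.add_sub_cancel_left, coe_lucas_sq]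
  have hk₁ := hB (k + m)
  have hk₂ := hB m
  have hs₁ := hsign (k + m)
  have hs₂ := hsign m
  simp only [pow_add _ (k + m) k]
  simp only [pow_add _ k m] at hk₁ hs₁ ⊢
  linear_combination (-((2 * (k + m)).choose (k + m + k) : ℝ)) *
    ((Real.goldenRatio ^ 2) ^ k * hk₁ + (Real.goldenConj ^ 2) ^ k * hk₂
      + (-1) ^ k * hs₁ + (-1) ^ k * hs₂)
end

section
/- For every non-negative integer n, the integer \(35 \cdot 4^{n} + 7^{2n} + 8(-1)^{n+1} \cdot 4^{2n} + 28 \cdot 3^{2n} + 56(-1)^{n+1}\) is divisible by 625. -/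
/-- The sequence satisfies the linear recurrence with characteristic roots
`4, 49, -16, 9, -1`, so divisibility propagates from its first five terms. -/
theorem dvd_625_of_powers : ∀ n : ℕ,
    (625 : ℤ) ∣ 35 * 4 ^ n + 49 ^ n - 8 * (-16) ^ n + 28 * 9 ^ n - 56 * (-1) ^ n
  | 0 | 1 | 2 | 3 | 4 => by norm_num
  | n + 5 => by
    obtain ⟨a, ha⟩ := dvd_625_of_powers n
    obtain ⟨b, hb⟩ := dvd_625_of_powers (n + 1)
    obtain ⟨c, hc⟩ := dvd_625_of_powers (n + 2)
    obtain ⟨d, hd⟩ := dvd_625_of_powers (n + 3)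
    obtain ⟨e, he⟩ := dvd_625_of_powers (n + 4)
    refine ⟨45 * e + 365 * d - 8685 * c + 19220 * b + 28224 * a, ?_⟩
    simp only [pow_succ] at *
    linear_combination 45 * he + 365 * hd - 8685 * hc + 19220 * hb + 28224 * ha

/-- For every non-negative integer `n`,
`625 ∣ 35·4^n + 7^{2n} + 8(-1)^{n+1}·4^{2n} + 28·3^{2n} + 56(-1)^{n+1}` (as integers). -/
theorem dvd_625 (n : ℕ) :
    (625 : ℤ) ∣ 35 * 4 ^ n + 7 ^ (2 * n) + 8 * (-1) ^ (n + 1) * 4 ^ (2 * n) +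
        28 * 3 ^ (2 * n) + 56 * (-1) ^ (n + 1) := by
  have h16 : (-16 : ℤ) ^ n = (-1) ^ n * 16 ^ n := by
    rw [← mul_pow]
    norm_num
  convert dvd_625_of_powers n using 1
  rw [pow_mul, pow_mul, pow_mul, h16]
  norm_num
  ring
end

section
/- Let \(\{a_{n}\}\) and \(\{b_{n}\}\) be the integer sequences defined by \(a_{0}=b_{0}=0,\ a_{1}=1,\ b_{1}=0\), and \(a_{n+1}=3b_{n}+a_{n-1},\ b_{n+1}=a_{n}+b_{n-1}\) for \(n \geq 1\). Then for every positive integer n, \(\sum_{k=0}^{n} \binom{2n}{n+k}\big(a_{k}^{2} + 3 b_{k}^{2}\big) = 7^{n-1}\). -/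
/-- Summation by parts for a sequence with `w (k+2) = 5 w (k+1) - w k - 2 (-1)^k`, against the
second-order binomial weights `c k + 2 c (k+1) + c (k+2)`. -/
lemma sum_second_order_weights (c w : ℕ → ℤ) (hw0 : w 0 = 0) (hw1 : w 1 = 1)
    (hw : ∀ k, w (k + 2) = 5 * w (k + 1) - w k - 2 * (-1) ^ k) (N : ℕ) :
    ∑ k ∈ Finset.range N, (c k + 2 * c (k + 1) + c (k + 2)) * w (k + 1) =
      7 * ∑ k ∈ Finset.range N, c k * w k + 2 * ∑ k ∈ Finset.range N, c k * (-1) ^ k - c 0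
        + c N * (7 * w N + 2 * (-1) ^ N - w (N + 1)) + c (N + 1) * w N := by
  induction N with
  | zero => simp [hw0, hw1]
  | succ N ih =>
    rw [Finset.sum_range_succ, Finset.sum_range_succ, Finset.sum_range_succ, ih, hw N]
    ring

lemma choose_add_two_add_two (m j : ℕ) :
    (m + 2).choose (j + 2) = m.choose j + 2 * m.choose (j + 1) + m.choose (j + 2) := by
  simp only [Nat.choose_succ_succ']
  ring

lemma sum_range_choose_succ_mul_neg_one_pow (m j N : ℕ) :
    ∑ k ∈ Finset.range N, ((m + 1).choose (j + 1 + k) : ℤ) * (-1) ^ k =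
      m.choose j - (-1) ^ N * m.choose (j + N) := by
  induction N with
  | zero => simp
  | succ N ih =>
    rw [Finset.sum_range_succ, ih, show j + 1 + N = j + N + 1 by ring, Nat.choose_succ_succ',
      ← add_assoc j N 1]
    push_cast
    ring

lemma two_mul_sum_range_choose_mul_neg_one_pow {n : ℕ} (hn : 0 < n) :
    2 * ∑ k ∈ Finset.range (n + 1), ((2 * n).choose (n + k) : ℤ) * (-1) ^ k =
      (2 * n).choose n := by
  obtain ⟨m, rfl⟩ := Nat.exists_eq_add_of_lt hn
  simp only [zero_add]
  have h := sum_range_choose_succ_mul_neg_one_pow (2 * m + 1) m (m + 2)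
  rw [Nat.choose_eq_zero_of_lt (show 2 * m + 1 < m + (m + 2) by lia)] at h
  rw [show 2 * (m + 1) = 2 * m + 1 + 1 by ring, h, Nat.choose_succ_succ',
    Nat.choose_symm_half]
  push_cast
  ring

lemma cassini_sqrt3_fib (a b : ℕ → ℤ)
    (ha0 : a 0 = 0) (hb0 : b 0 = 0) (ha1 : a 1 = 1) (hb1 : b 1 = 0)
    (ha : ∀ n : ℕ, a (n + 2) = 3 * b (n + 1) + a n)
    (hb : ∀ n : ℕ, b (n + 2) = a (n + 1) + b n) (k : ℕ) :
    (a (k + 1) ^ 2 + 3 * b (k + 1) ^ 2) - 3 * (a k * b (k + 1) + a (k + 1) * b k)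
      - (a k ^ 2 + 3 * b k ^ 2) = (-1) ^ k := by
  induction k with
  | zero => simp [ha0, hb0, ha1, hb1]
  | succ k ih =>
    rw [ha, hb, pow_succ (-1 : ℤ) k, ← ih]
    ring

lemma sum_choose_mul_succ (w : ℕ → ℤ) (hw0 : w 0 = 0) (hw1 : w 1 = 1)
    (hw : ∀ k, w (k + 2) = 5 * w (k + 1) - w k - 2 * (-1) ^ k) {n : ℕ} (hn : 0 < n) :
    ∑ k ∈ Finset.range (n + 2), ((2 * (n + 1)).choose (n + 1 + k) : ℤ) * w k =
      7 * ∑ k ∈ Finset.range (n + 1), ((2 * n).choose (n + k) : ℤ) * w k := by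
  have h := sum_second_order_weights (fun k => ((2 * n).choose (n + k) : ℤ)) w hw0 hw1 hw (n + 1)
  simp only [two_mul_sum_range_choose_mul_neg_one_pow hn, add_zero,
    Nat.choose_eq_zero_of_lt (show 2 * n < n + (n + 1) by lia),
    Nat.choose_eq_zero_of_lt (show 2 * n < n + (n + 1 + 1) by lia)] at h
  rw [Finset.sum_range_succ', hw0, mul_zero, add_zero]
  have hc (k : ℕ) : ((2 * (n + 1)).choose (n + 1 + (k + 1)) : ℤ) =
      (2 * n).choose (n + k) + 2 * (2 * n).choose (n + (k + 1))
        + (2 * n).choose (n + (k + 2)) := by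
    rw [show 2 * (n + 1) = 2 * n + 2 by ring, show n + 1 + (k + 1) = n + k + 2 by ring,
      choose_add_two_add_two]
    push_cast
    rfl
  simp only [hc, h]
  push_cast
  ring

/-- Let `a`, `b` be the integer sequences with `a 0 = b 0 = 0`, `a 1 = 1`, `b 1 = 0`,
and `a (n+1) = 3 b n + a (n-1)`, `b (n+1) = a n + b (n-1)` for `n ≥ 1`.
Then for every positive integer `n`,
`∑_{k=0}^n C(2n, n+k) (a_k² + 3 b_k²) = 7^{n-1}`. -/
theorem sum_choose_sqrt3_fib (a b : ℕ → ℤ)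
    (ha0 : a 0 = 0) (hb0 : b 0 = 0) (ha1 : a 1 = 1) (hb1 : b 1 = 0)
    (ha : ∀ n : ℕ, a (n + 2) = 3 * b (n + 1) + a n)
    (hb : ∀ n : ℕ, b (n + 2) = a (n + 1) + b n)
    (n : ℕ) (hn : 0 < n) :
    ∑ k ∈ Finset.range (n + 1),
        ((Nat.choose (2 * n) (n + k) : ℤ) * (a k ^ 2 + 3 * b k ^ 2)) =
      7 ^ (n - 1) := by
  have hw (k : ℕ) : a (k + 2) ^ 2 + 3 * b (k + 2) ^ 2 =
      5 * (a (k + 1) ^ 2 + 3 * b (k + 1) ^ 2) - (a k ^ 2 + 3 * b k ^ 2) - 2 * (-1) ^ k := by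
    rw [ha, hb, ← cassini_sqrt3_fib a b ha0 hb0 ha1 hb1 ha hb k]
    ring
  induction n, hn using Nat.le_induction with
  | base => simp [Finset.sum_range_succ, ha0, hb0, ha1, hb1]
  | succ n hn ih =>
    have h := sum_choose_mul_succ (fun k => a k ^ 2 + 3 * b k ^ 2)
      (by simp [ha0, hb0]) (by simp [ha1, hb1]) hw hn
    rw [h, ih, ← pow_succ', Nat.sub_add_cancel hn, Nat.add_sub_cancel]
end
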